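/- Suppose G is a regular nonbipartite connected finite graph (multiple edges allowed, no loops) that has a 2-factor, w ∈ V(G), and λ ∈ {0,1}. Then G has a spanning even (w,λ)-tree, i.e., a spanning tree T such that in the bipartition of T in which w lies in the part of type λ, every leaf of T lies in the type-0 part. -/

import Mathlib

/-- A multigraph on vertex type `V` with edge type `E`: each edge is assigned an
unordered pair of distinct endpoints (multiple edges allowed, no loops). -/
structure Multigraph (V : Type) (E : Type) where
  inc : E → Sym2 V
  loopless : ∀ e : E, ¬ (inc e).IsDiag

namespace Multigraph

variable {V E : Type}

/-- `u` and `v` are joined by an edge belonging to the edge set `S`. -/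
def AdjOn (G : Multigraph V E) (S : Set E) (u v : V) : Prop :=
  ∃ e ∈ S, G.inc e = s(u, v)

/-- `v` is reachable from `u` using edges in `S`. -/
def ReachOn (G : Multigraph V E) (S : Set E) (u v : V) : Prop :=
  Relation.ReflTransGen (G.AdjOn S) u v

/-- `G` is connected. -/
def Connected (G : Multigraph V E) : Prop :=
  Nonempty V ∧ ∀ u v : V, G.ReachOn Set.univ u v

/-- The degree of `v` in the spanning subgraph with edge set `S`. -/
noncomputable def degOn (G : Multigraph V E) (S : Set E) (v : V) : ℕ :=
  {e ∈ S | v ∈ G.inc e}.ncard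

/-- The degree of `v` in `G`. -/
noncomputable def degree (G : Multigraph V E) (v : V) : ℕ :=
  G.degOn Set.univ v

/-- The maximum degree `Δ(G)`. -/
noncomputable def maxDegree (G : Multigraph V E) [Fintype V] : ℕ :=
  Finset.univ.sup G.degree

/-- `G` is regular. -/
def IsRegular (G : Multigraph V E) : Prop :=
  ∃ r : ℕ, ∀ v : V, G.degree v = r

/-- The 2-colouring `c` is proper on the edge set `S`: the two endpoints of any
edge of `S` receive different colours. -/
def ProperOn (G : Multigraph V E) (S : Set E) (c : V → Bool) : Prop :=
  ∀ e ∈ S, ∀ u v : V, G.inc e = s(u, v) → c u ≠ c v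

/-- `G` is bipartite. -/
def IsBipartite (G : Multigraph V E) : Prop :=
  ∃ c : V → Bool, G.ProperOn Set.univ c

/-- The sub-multigraph of `G` with vertex set `U` and edge set `S` is a tree:
`U` is nonempty, every edge of `S` joins vertices of `U`, any two vertices of `U`
are joined by a walk using edges of `S`, and there are exactly `|U| - 1` edges
(which forces acyclicity, and in particular forbids parallel edges in `S`). -/
structure IsTree (G : Multigraph V E) (U : Set V) (S : Set E) : Prop where
  nonempty : U.Nonempty
  edges_in : ∀ e ∈ S, ∀ v : V, v ∈ G.inc e → v ∈ U
  conn : ∀ u ∈ U, ∀ v ∈ U, G.ReachOn S u v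
  card_eq : S.ncard + 1 = U.ncard

/-- `v` is a leaf of the subgraph with edge set `S`. -/
def IsLeaf (G : Multigraph V E) (S : Set E) (v : V) : Prop :=
  G.degOn S v = 1

/-- `e` is a cutedge: after removing `e`, some pair of vertices is separated. -/
def IsCutedge (G : Multigraph V E) (e : E) : Prop :=
  ∃ u v : V, ¬ G.ReachOn {e}ᶜ u v

/-- `G` is 2-edge-connected: connected and without cutedges. -/
def TwoEdgeConnected (G : Multigraph V E) : Prop :=
  G.Connected ∧ ∀ e : E, ¬ G.IsCutedge e

/-- The edge set `S` is a weak 2-factor of `G`: every vertex has degree at most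
2 in `S` (equivalently, every component of the spanning subgraph is a path —
possibly a single vertex — or a cycle), and every vertex of degree less than 2
in `S` (i.e. every endvertex of a path component) has degree less than `Δ(G)`
in `G`. -/
def IsWeakTwoFactor (G : Multigraph V E) [Fintype V] (S : Set E) : Prop :=
  ∀ v : V, G.degOn S v ≤ 2 ∧ (G.degOn S v < 2 → G.degree v < G.maxDegree)

end Multigraph

namespace Multigraph

set_option linter.unusedSectionVars false
set_option linter.unusedSimpArgs false

lemma AdjOn.symm' {V E : Type} {G : Multigraph V E} {S : Set E} {u v : V} (h : G.AdjOn S u v) :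
    G.AdjOn S v u := by
  obtain ⟨e, he, h⟩ := h
  exact ⟨e, he, by rw [h, Sym2.eq_swap]⟩

lemma AdjOn.mono' {V E : Type} {G : Multigraph V E} {S T : Set E} (hST : S ⊆ T) {u v : V}
    (h : G.AdjOn S u v) : G.AdjOn T u v := by
  obtain ⟨e, he, h⟩ := h
  exact ⟨e, hST he, h⟩

lemma AdjOn.ne' {V E : Type} {G : Multigraph V E} {S : Set E} {u v : V} (h : G.AdjOn S u v) :
    u ≠ v := by
  obtain ⟨e, he, h⟩ := h
  rintro rfl
  apply G.loopless e
  rw [h]; simp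

/-- A tree on `U` with edges `S`, properly coloured by `c`, where all type-1 vertices outside
`L` have degree at least two. -/
structure Good {V E : Type} (G : Multigraph V E) (c : V → Bool) (U : Set V) (S : Set E)
    (L : Set V) : Prop where
  tree : G.IsTree U S
  proper : G.ProperOn S c
  deg1 : ∀ v ∈ U, c v = true → 1 ≤ G.degOn S v
  deg2 : ∀ v ∈ U, c v = true → v ∉ L → 2 ≤ G.degOn S v

section
variable {V E : Type} [Fintype V] [Fintype E] {G : Multigraph V E}

lemma Good.mono {c : V → Bool} {U : Set V} {S : Set E} {L L' : Set V} (h : G.Good c U S L)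
    (hL : ∀ v ∈ U, v ∈ L → c v = true → v ∈ L') : G.Good c U S L' :=
  ⟨h.tree, h.proper, h.deg1, fun v hv hc hn => h.deg2 v hv hc (fun h' => hn (hL v hv h' hc))⟩

lemma Good.congr {c c' : V → Bool} {U : Set V} {S : Set E} {L : Set V} (h : G.Good c U S L)
    (hc : ∀ v ∈ U, c' v = c v) : G.Good c' U S L := by
  refine ⟨h.tree, ?_, ?_, ?_⟩
  · intro e he u v huv
    rw [hc u (h.tree.edges_in e he u (by rw [huv]; simp)),
      hc v (h.tree.edges_in e he v (by rw [huv]; simp))]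
    exact h.proper e he u v huv
  · intro v hv h1; rw [hc v hv] at h1; exact h.deg1 v hv h1
  · intro v hv h1; rw [hc v hv] at h1; exact h.deg2 v hv h1

lemma degOn_mono {S T : Set E} (h : S ⊆ T) (v : V) : G.degOn S v ≤ G.degOn T v := by
  apply Set.ncard_le_ncard _ (Set.toFinite _)
  rintro e ⟨h1, h2⟩
  exact ⟨h h1, h2⟩

lemma degOn_insert {S : Set E} {e : E} (he : e ∉ S) {v : V} (hv : v ∈ G.inc e) :
    G.degOn (insert e S) v = G.degOn S v + 1 := by
  unfold degOn
  rw [← Set.ncard_insert_of_notMem (a := e) (by simp [he]) (Set.toFinite _)]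
  congr 1
  ext f
  simp only [Set.mem_insert_iff, Set.mem_ofPred_eq]
  constructor
  · rintro ⟨rfl | h, h2⟩
    · left; rfl
    · right; exact ⟨h, h2⟩
  · rintro (rfl | ⟨h, h2⟩)
    · exact ⟨Or.inl rfl, hv⟩
    · exact ⟨Or.inr h, h2⟩

lemma Good.single (c : V → Bool) (v : V) (hv : c v = false) (L : Set V) :
    G.Good c {v} ∅ L := by
  refine ⟨⟨⟨v, rfl⟩, by simp, ?_, by simp⟩, ?_, ?_, ?_⟩
  · rintro u rfl v rfl; exact Relation.ReflTransGen.refl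
  · intro e he; simp at he
  · rintro u rfl h; simp [hv] at h
  · rintro u rfl h; simp [hv] at h

lemma Good.pendant {c : V → Bool} {U : Set V} {S : Set E} {L : Set V} (h : G.Good c U S L)
    {x v : V} (hx : x ∈ U) (hv : v ∉ U) (hadj : G.AdjOn Set.univ x v) (hc : c x ≠ c v) :
    ∃ S', G.Good c (insert v U) S' ((L \ {x}) ∪ {v}) := by
  obtain ⟨e, -, he⟩ := hadj
  have heS : e ∉ S := fun h' => hv (h.tree.edges_in e h' v (by rw [he]; simp))
  have hmono : ∀ a b, G.ReachOn S a b → G.ReachOn (insert e S) a b := by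
    intro a b hab
    exact Relation.ReflTransGen.mono
      (fun a b h => AdjOn.mono' (Set.subset_insert _ _) h) _ _ hab
  have hxv : G.ReachOn (insert e S) x v := Relation.ReflTransGen.single ⟨e, by simp, he⟩
  have hvx : G.ReachOn (insert e S) v x :=
    Relation.ReflTransGen.single ⟨e, by simp, by rw [he, Sym2.eq_swap]⟩
  refine ⟨insert e S, ⟨⟨⟨v, by simp⟩, ?_, ?_, ?_⟩, ?_, ?_, ?_⟩⟩
  · rintro f (rfl | hf) a ha
    · rw [he] at ha
      rcases Sym2.mem_iff.1 ha with rfl | rfl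
      · right; exact hx
      · left; rfl
    · right; exact h.tree.edges_in f hf a ha
  · rintro a (rfl | ha) b (rfl | hb)
    · exact Relation.ReflTransGen.refl
    · exact hvx.trans (hmono _ _ (h.tree.conn x hx b hb))
    · exact (hmono _ _ (h.tree.conn a ha x hx)).trans hxv
    · exact hmono _ _ (h.tree.conn a ha b hb)
  · rw [Set.ncard_insert_of_notMem heS (Set.toFinite _),
      Set.ncard_insert_of_notMem hv (Set.toFinite _), h.tree.card_eq]
  · rintro f (rfl | hf) a b hab
    · rw [he] at hab
      rcases Sym2.eq_iff.1 hab with ⟨rfl, rfl⟩ | ⟨rfl, rfl⟩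
      · exact hc
      · exact hc.symm
    · exact h.proper f hf a b hab
  · rintro a (rfl | ha) hca
    · rw [degOn_insert heS (by rw [he]; simp)]; omega
    · exact (h.deg1 a ha hca).trans (degOn_mono (Set.subset_insert _ _) a)
  · rintro a (rfl | ha) hca hL
    · simp at hL
    · by_cases hax : a = x
      · subst hax
        rw [degOn_insert heS (by rw [he]; simp)]
        have := h.deg1 a ha hca
        omega
      · refine (h.deg2 a ha hca ?_).trans (degOn_mono (Set.subset_insert _ _) a)
        intro h'; apply hL; left; exact ⟨h', hax⟩

lemma Good.addPath1 {c : V → Bool} {U : Set V} {S : Set E} {L : Set V} (h : G.Good c U S L)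
    {x : V} (hx : x ∈ U) (p : ℕ → V) (m : ℕ)
    (hx0 : G.AdjOn Set.univ x (p 0)) (hadj : ∀ i < m, G.AdjOn Set.univ (p i) (p (i + 1)))
    (hinj : ∀ i ≤ m, ∀ j ≤ m, p i = p j → i = j) (hU : ∀ i ≤ m, p i ∉ U)
    (hcx : c x ≠ c (p 0)) (hc : ∀ i < m, c (p i) ≠ c (p (i + 1))) :
    ∃ S', G.Good c (U ∪ p '' {i | i ≤ m}) S' ((L \ {x}) ∪ {p m}) := by
  induction m with
  | zero =>
    obtain ⟨S', hS'⟩ := h.pendant hx (hU 0 le_rfl) hx0 hcx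
    refine ⟨S', ?_⟩
    have : U ∪ p '' {i | i ≤ 0} = insert (p 0) U := by
      ext v; simp [eq_comm, or_comm]
    rw [this]; exact hS'
  | succ m ih =>
    obtain ⟨S', hS'⟩ := ih (fun i hi => hadj i (by omega))
      (fun i hi j hj => hinj i (by omega) j (by omega)) (fun i hi => hU i (by omega))
      (fun i hi => hc i (by omega))
    obtain ⟨S'', hS''⟩ := hS'.pendant (x := p m) (v := p (m + 1)) (Or.inr ⟨m, by simp, rfl⟩)
      (by
        rintro (h1 | ⟨i, hi, h1⟩)
        · exact hU _ le_rfl h1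
        · simp only [Set.mem_ofPred_eq] at hi
          have := hinj i (by omega) (m + 1) le_rfl h1
          omega) (hadj m (by omega)) (hc m (by omega))
    refine ⟨S'', ?_⟩
    have : U ∪ p '' {i | i ≤ m + 1} = insert (p (m + 1)) (U ∪ p '' {i | i ≤ m}) := by
      ext v
      simp only [Set.mem_union, Set.mem_image, Set.mem_ofPred_eq, Set.mem_insert_iff]
      constructor
      · rintro (h1 | ⟨i, hi, rfl⟩)
        · tauto
        · rcases Nat.lt_or_ge m i with h2 | h2
          · left; congr 1; omega
          · right; right; exact ⟨i, h2, rfl⟩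
      · rintro (rfl | h1 | ⟨i, hi, rfl⟩)
        · right; exact ⟨m + 1, le_rfl, rfl⟩
        · left; exact h1
        · right; exact ⟨i, by omega, rfl⟩
    rw [this]
    refine hS''.mono ?_
    rintro v - (⟨h1 | h1, h2⟩ | h1) -
    · left; exact h1
    · exact absurd h1 h2
    · right; exact h1

/-- add a nonempty path `p 0, …, p (m-1)` whose end has type 0 -/
lemma Good.addPath {c : V → Bool} {U : Set V} {S : Set E} {L : Set V} (h : G.Good c U S L)
    {x : V} (hx : x ∈ U) (p : ℕ → V) (m : ℕ) (hm : 0 < m)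
    (hx0 : G.AdjOn Set.univ x (p 0)) (hadj : ∀ i, i + 1 < m → G.AdjOn Set.univ (p i) (p (i + 1)))
    (hinj : ∀ i < m, ∀ j < m, p i = p j → i = j) (hU : ∀ i < m, p i ∉ U)
    (hcx : c x ≠ c (p 0)) (hc : ∀ i, i + 1 < m → c (p i) ≠ c (p (i + 1)))
    (hlast : c (p (m - 1)) = false) :
    ∃ S', G.Good c (U ∪ p '' {i | i < m}) S' (L \ {x}) := by
  obtain ⟨m, rfl⟩ : ∃ k, m = k + 1 := ⟨m - 1, by omega⟩
  obtain ⟨S', hS'⟩ := h.addPath1 hx p m hx0 (fun i hi => hadj i (by omega))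
    (fun i hi j hj => hinj i (by omega) j (by omega)) (fun i hi => hU i (by omega)) hcx
    (fun i hi => hc i (by omega))
  refine ⟨S', ?_⟩
  have : {i | i < m + 1} = {i | i ≤ m} := by ext; simp [Nat.lt_succ_iff]
  rw [this]
  refine hS'.mono ?_
  rintro v - (h1 | h1) h2
  · exact h1
  · simp only [Set.mem_singleton_iff] at h1
    subst h1
    simp at hlast
    simp [hlast] at h2

/-- possibly empty path, no improvement of `L` -/
lemma Good.addPath0 {c : V → Bool} {U : Set V} {S : Set E} {L : Set V} (h : G.Good c U S L)
    {x : V} (hx : x ∈ U) (p : ℕ → V) (m : ℕ)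
    (hx0 : 0 < m → G.AdjOn Set.univ x (p 0))
    (hadj : ∀ i, i + 1 < m → G.AdjOn Set.univ (p i) (p (i + 1)))
    (hinj : ∀ i < m, ∀ j < m, p i = p j → i = j) (hU : ∀ i < m, p i ∉ U)
    (hcx : 0 < m → c x ≠ c (p 0)) (hc : ∀ i, i + 1 < m → c (p i) ≠ c (p (i + 1)))
    (hlast : 0 < m → c (p (m - 1)) = false) :
    ∃ S', G.Good c (U ∪ p '' {i | i < m}) S' L := by
  rcases Nat.eq_zero_or_pos m with rfl | hm
  · exact ⟨S, by simpa using h⟩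
  · obtain ⟨S', hS'⟩ := h.addPath hx p m hm (hx0 hm) hadj hinj hU (hcx hm) hc (hlast hm)
    exact ⟨S', hS'.mono (fun v _ h1 _ => h1.1)⟩

/-- closed under `F`-adjacency -/
def FClosed (G : Multigraph V E) (F : Set E) (U : Set V) : Prop :=
  ∀ a b, G.AdjOn F a b → a ∈ U → b ∈ U

structure Cyc (G : Multigraph V E) (F : Set E) (u : V) (n : ℕ) (d : ℕ → V) : Prop where
  zero : d 0 = u
  two : 2 ≤ n
  inj : ∀ i < n, ∀ j < n, d i = d j → i = j
  adj : ∀ i, i + 1 < n → G.AdjOn F (d i) (d (i + 1))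
  wrap : G.AdjOn F (d (n - 1)) (d 0)
  nbr : ∀ i < n, ∀ b, G.AdjOn F (d i) b →
    ∃ j < n, b = d j ∧ (j = i + 1 ∨ i = j + 1 ∨ (i = 0 ∧ j = n - 1) ∨ (j = 0 ∧ i = n - 1))

lemma two_edges {F : Set E} {v : V} (h : G.degOn F v = 2) {e f g : E} (he : e ∈ F) (hf : f ∈ F)
    (hg : g ∈ F) (hve : v ∈ G.inc e) (hvf : v ∈ G.inc f) (hvg : v ∈ G.inc g) (hef : e ≠ f) :
    g = e ∨ g = f := by
  unfold degOn at h
  have hsub : ({e, f} : Set E) ⊆ {e ∈ F | v ∈ G.inc e} := by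
    rintro x (rfl | rfl)
    · exact ⟨he, hve⟩
    · exact ⟨hf, hvf⟩
  have := Set.eq_of_subset_of_ncard_le hsub (by rw [h, Set.ncard_pair hef]) (Set.toFinite _)
  have hg' : g ∈ ({e, f} : Set E) := by rw [this]; exact ⟨hg, hvg⟩
  simpa using hg'

lemma exists_cyc {F : Set E} (hF : ∀ v, G.degOn F v = 2) (u : V) : ∃ n d, G.Cyc F u n d := by
  have step : ∀ s : {s : V × E // s.2 ∈ F ∧ s.1 ∈ G.inc s.2},
      ∃ t : {s : V × E // s.2 ∈ F ∧ s.1 ∈ G.inc s.2},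
        G.inc s.1.2 = s(s.1.1, t.1.1) ∧ t.1.2 ≠ s.1.2 := by
    rintro ⟨⟨v, e⟩, he, hv⟩
    obtain ⟨v', hv'⟩ := hv
    have h2 := hF v'
    unfold degOn at h2
    obtain ⟨e', he', hne⟩ := Set.exists_ne_of_one_lt_ncard (by rw [h2]; norm_num) e
    exact ⟨⟨⟨v', e'⟩, he'.1, he'.2⟩, hv', hne⟩
  choose nx hnx1 hnx2 using step
  have h0 : ∃ e, e ∈ F ∧ u ∈ G.inc e := by
    have h2 := hF u
    unfold degOn at h2
    obtain ⟨e', he'⟩ := Set.nonempty_of_ncard_ne_zero (by rw [h2]; norm_num)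
    exact ⟨e', he'⟩
  obtain ⟨e0, he0, hu0⟩ := h0
  let s : ℕ → {s : V × E // s.2 ∈ F ∧ s.1 ∈ G.inc s.2} :=
    fun k => Nat.rec ⟨(u, e0), he0, hu0⟩ (fun _ t => nx t) k
  obtain ⟨d, hd⟩ : ∃ d : ℕ → V, ∀ i, d i = (s i).1.1 := ⟨_, fun _ => rfl⟩
  obtain ⟨e, hee⟩ : ∃ e : ℕ → E, ∀ i, e i = (s i).1.2 := ⟨_, fun _ => rfl⟩
  have hd0 : d 0 = u := by rw [hd]; rfl
  have heF : ∀ i, e i ∈ F := fun i => by rw [hee]; exact (s i).2.1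
  have hinc : ∀ i, G.inc (e i) = s(d i, d (i + 1)) := fun i => by
    rw [hee, hd, hd]; exact hnx1 (s i)
  have hne : ∀ i, e (i + 1) ≠ e i := fun i => by
    rw [hee, hee]; exact hnx2 (s i)
  clear_value s
  clear hd hee s hnx1 hnx2 nx
  have hdne : ∀ i, d i ≠ d (i + 1) := fun i h => G.loopless (e i) (by rw [hinc, h]; simp)
  have hex : ∃ j, ∃ i < j, d i = d j := by
    obtain ⟨a, b, hab, h⟩ := Finite.exists_ne_map_eq_of_infinite d
    rcases lt_or_gt_of_ne hab with h1 | h1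
    · exact ⟨b, a, h1, h⟩
    · exact ⟨a, b, h1, h.symm⟩
  classical
  let n := Nat.find hex
  obtain ⟨k, hkn, hk⟩ : ∃ i < n, d i = d n := Nat.find_spec hex
  have hmin : ∀ j < n, ∀ i < j, d i ≠ d j := fun j hj i hi h =>
    Nat.find_min hex hj ⟨i, hi, h⟩
  clear_value n
  have hinj : ∀ i < n, ∀ j < n, d i = d j → i = j := by
    intro i hi j hj h
    rcases lt_trichotomy i j with h1 | h1 | h1
    · exact absurd h (hmin j hj i h1)
    · exact h1
    · exact absurd h.symm (hmin i hi j h1)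
  have hn2 : k + 2 ≤ n := by
    rcases Nat.lt_or_ge n (k + 2) with h | h
    · have : n = k + 1 := by omega
      subst this; exact absurd hk (hdne k)
    · exact h
  -- edges at the closing vertex
  have hclose : e (n - 1) ≠ e k := by
    intro h
    have h1 := hinc (n - 1)
    rw [h, hinc k, Nat.sub_add_cancel (by omega), ← hk] at h1
    have h2 : d (k + 1) = d (n - 1) := by
      rcases Sym2.eq_iff.1 h1 with ⟨h3, h4⟩ | ⟨h3, h4⟩
      · exact absurd h4.symm (hdne k)
      · exact h4
    have h3 := hinj _ (by omega) _ (by omega) h2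
    have : n - 1 = k + 1 := by omega
    rw [this] at h
    exact hne k h
  have hk0 : k = 0 := by
    by_contra hk0
    obtain ⟨l, rfl⟩ : ∃ l, k = l + 1 := ⟨k - 1, by omega⟩
    rcases two_edges (hF (d (l + 1))) (heF l) (heF (l + 1)) (heF (n - 1)) (by rw [hinc]; simp)
      (by rw [hinc]; simp) (by rw [hinc, Nat.sub_add_cancel (by omega), hk]; simp)
      (hne l).symm with h | h
    · have h1 := hinc (n - 1)
      rw [h, hinc l, Nat.sub_add_cancel (by omega), ← hk] at h1
      have h2 : d l = d (n - 1) := by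
        rcases Sym2.eq_iff.1 h1 with ⟨h3, h4⟩ | ⟨h3, h4⟩
        · exact h3
        · exact absurd h3 (hdne l)
      have := hinj _ (by omega) _ (by omega) h2
      omega
    · exact hclose h
  subst hk0
  have hwrap : G.inc (e (n - 1)) = s(d (n - 1), d 0) := by
    rw [hinc, Nat.sub_add_cancel (by omega), hk]
  refine ⟨n, d, hd0, by omega, hinj, fun i _ => ⟨e i, heF i, hinc i⟩, ⟨_, heF _, hwrap⟩, ?_⟩
  rintro i hi b ⟨g, hg, hgb⟩
  rcases Nat.eq_zero_or_pos i with rfl | hipos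
  · rcases two_edges (hF (d 0)) (heF (n - 1)) (heF 0) hg (by rw [hwrap]; simp)
      (by rw [hinc]; simp) (by rw [hgb]; simp) hclose with h | h
    · rw [h, hwrap] at hgb
      rw [Sym2.eq_swap] at hgb
      have := Sym2.congr_right.1 hgb
      exact ⟨n - 1, by omega, this.symm, by simp⟩
    · rw [h, hinc] at hgb
      have := Sym2.congr_right.1 hgb
      exact ⟨1, by omega, this.symm, by simp⟩
  · obtain ⟨l, rfl⟩ : ∃ l, i = l + 1 := ⟨i - 1, by omega⟩
    rcases two_edges (hF (d (l + 1))) (heF l) (heF (l + 1)) hg (by rw [hinc]; simp)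
      (by rw [hinc]; simp) (by rw [hgb]; simp) (hne l).symm with h | h
    · rw [h, hinc, Sym2.eq_swap] at hgb
      have := Sym2.congr_right.1 hgb
      exact ⟨l, by omega, this.symm, by simp⟩
    · rw [h, hinc] at hgb
      have := Sym2.congr_right.1 hgb
      by_cases hl : l + 2 < n
      · exact ⟨l + 2, hl, this.symm, by simp⟩
      · have hl : l + 1 + 1 = n := by omega
        refine ⟨0, by omega, ?_, by right; right; right; omega⟩
        rw [← this, hl, hk]

lemma Cyc.all_mem {F : Set E} {u : V} {n : ℕ} {d : ℕ → V} (h : G.Cyc F u n d) {A : Set V}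
    (hA : G.FClosed F A) {k : ℕ} (hk : k < n) (hkA : d k ∈ A) : ∀ i < n, d i ∈ A := by
  have h0 : d 0 ∈ A := by
    induction k with
    | zero => exact hkA
    | succ k ih => exact ih (by omega) (hA _ _ (h.adj k hk).symm' hkA)
  intro i hi
  induction i with
  | zero => exact h0
  | succ i ih => exact hA _ _ (h.adj i hi) (ih (by omega))

lemma Cyc.closed {F : Set E} {u : V} {n : ℕ} {d : ℕ → V} (h : G.Cyc F u n d) :
    G.FClosed F (d '' {i | i < n}) := by
  rintro a b hab ⟨i, hi, rfl⟩
  obtain ⟨j, hj, rfl, -⟩ := h.nbr i hi b hab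
  exact ⟨j, hj, rfl⟩

lemma Cyc.disj {F : Set E} {u : V} {n : ℕ} {d : ℕ → V} (h : G.Cyc F u n d) {A : Set V}
    (hA : G.FClosed F A) (hu : u ∉ A) : ∀ i < n, d i ∉ A := by
  intro i hi hiA
  apply hu
  rw [← h.zero]
  exact h.all_mem hA hi hiA 0 (by have := h.two; omega)

lemma FClosed.union {F : Set E} {A B : Set V} (hA : G.FClosed F A) (hB : G.FClosed F B) :
    G.FClosed F (A ∪ B) := by
  rintro a b hab (h | h)
  · left; exact hA _ _ hab h
  · right; exact hB _ _ hab h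

lemma Cyc.recolor {F : Set E} {u : V} {n : ℕ} {d : ℕ → V} (h : G.Cyc F u n d) (c : V → Bool)
    (g : ℕ → Bool) : ∃ c' : V → Bool, (∀ v, (∀ i < n, d i ≠ v) → c' v = c v) ∧
      ∀ i < n, c' (d i) = g i := by
  classical
  refine ⟨fun v => if hv : ∃ i < n, d i = v then g hv.choose else c v, ?_, ?_⟩
  · intro v hv
    simp only
    rw [dif_neg]
    rintro ⟨i, hi, h⟩
    exact hv i hi h
  · intro i hi
    have hex : ∃ j < n, d j = d i := ⟨i, hi, rfl⟩
    simp only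
    rw [dif_pos hex]
    congr 1
    exact h.inj _ hex.choose_spec.1 _ hi hex.choose_spec.2

lemma Cyc.adjU {F : Set E} {u : V} {n : ℕ} {d : ℕ → V} (h : G.Cyc F u n d) (i : ℕ)
    (hi : i + 1 < n) : G.AdjOn Set.univ (d i) (d (i + 1)) :=
  (h.adj i hi).mono' (Set.subset_univ _)

lemma Cyc.good_minus {F : Set E} {u : V} {n : ℕ} {d : ℕ → V} (hd : G.Cyc F u n d)
    {c : V → Bool} {U : Set V} {S : Set E} {L : Set V} (h : G.Good c U S L)
    {x : V} (hx : x ∈ U) (hcx : c x = true) (hxu : G.AdjOn Set.univ x u)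
    (hdis : ∀ i < n, d i ∉ U) (hn : n % 2 = 0) (hc : ∀ i < n, c (d i) = decide (i % 2 = 1))
    {j : ℕ} (hj : j < n) (hj1 : j % 2 = 1) :
    ∃ S', G.Good c (U ∪ d '' {i | i < n ∧ i ≠ j}) S' (L \ {x}) := by
  have hn2 := hd.two
  obtain ⟨S1, h1⟩ := h.addPath hx d j (by omega) (by rw [hd.zero]; exact hxu)
    (fun i hi => hd.adjU i (by omega)) (fun a ha b hb => hd.inj a (by omega) b (by omega))
    (fun i hi => hdis i (by omega)) (by rw [hcx, hc 0 (by omega)]; simp)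
    (fun i hi => by
      rw [hc i (by omega), hc (i + 1) (by omega)]
      simp only [ne_eq, decide_eq_decide]; omega)
    (by rw [hc _ (by omega)]; simp; omega)
  obtain ⟨S2, h2⟩ := h1.addPath0 (x := d 0) (Or.inr ⟨0, by simp; omega, rfl⟩)
    (fun i => d (n - 1 - i)) (n - 1 - j)
    (fun _ => (hd.wrap.mono' (Set.subset_univ _)).symm')
    (fun i hi => by
      have := (hd.adjU (n - 1 - (i + 1)) (by omega)).symm'
      rwa [show n - 1 - (i + 1) + 1 = n - 1 - i by omega] at this)
    (fun a ha b hb hab => by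
      have := hd.inj _ (by omega) _ (by omega) hab
      omega)
    (fun i hi => by
      rintro (h3 | ⟨k, hk, h3⟩)
      · exact hdis _ (by omega) h3
      · simp only [Set.mem_ofPred_eq] at hk
        have := hd.inj k (by omega) _ (by omega) h3
        omega)
    (fun _ => by
      rw [hc 0 (by omega), hc _ (by omega)]
      simp only [ne_eq, decide_eq_decide]; omega)
    (fun i hi => by
      rw [hc _ (by omega), hc _ (by omega)]
      simp only [ne_eq, decide_eq_decide]; omega)
    (fun _ => by
      rw [hc _ (by omega)]
      simp only [decide_eq_false_iff_not]; omega)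
  refine ⟨S2, ?_⟩
  convert h2 using 1
  ext v
  simp only [Set.mem_union, Set.mem_image, Set.mem_ofPred_eq]
  constructor
  · rintro (h3 | ⟨i, ⟨hi, hij⟩, rfl⟩)
    · left; left; exact h3
    · rcases lt_or_gt_of_ne hij with h4 | h4
      · left; right; exact ⟨i, h4, rfl⟩
      · right; exact ⟨n - 1 - i, by omega, by congr 1; omega⟩
  · rintro ((h3 | ⟨i, hi, rfl⟩) | ⟨i, hi, rfl⟩)
    · left; exact h3
    · right; exact ⟨i, by omega, rfl⟩
    · right; exact ⟨n - 1 - i, by omega, rfl⟩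

lemma union_minus (U : Set V) (d : ℕ → V) (n j : ℕ) (hj : j < n) :
    insert (d j) (U ∪ d '' {i | i < n ∧ i ≠ j}) = U ∪ d '' {i | i < n} := by
  ext v
  simp only [Set.mem_union, Set.mem_image, Set.mem_ofPred_eq, Set.mem_insert_iff]
  constructor
  · rintro (rfl | h3 | ⟨i, hi, rfl⟩)
    · right; exact ⟨j, hj, rfl⟩
    · left; exact h3
    · right; exact ⟨i, hi.1, rfl⟩
  · rintro (h3 | ⟨i, hi, rfl⟩)
    · right; left; exact h3
    · by_cases hij : i = j
      · left; rw [hij]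
      · right; right; exact ⟨i, ⟨hi, hij⟩, rfl⟩

lemma Cyc.notMem_minus {F : Set E} {u : V} {n : ℕ} {d : ℕ → V} (hd : G.Cyc F u n d)
    {U : Set V} {j : ℕ} (hj : j < n) (hdis : d j ∉ U) :
    d j ∉ U ∪ d '' {i | i < n ∧ i ≠ j} := by
  rintro (h3 | ⟨k, hk, h3⟩)
  · exact hdis h3
  · exact hk.2 (hd.inj k hk.1 j hj h3)

lemma Cyc.good_add {F : Set E} {u : V} {n : ℕ} {d : ℕ → V} (hd : G.Cyc F u n d)
    {c : V → Bool} {U : Set V} {S : Set E} {L : Set V} (h : G.Good c U S L)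
    {x : V} (hx : x ∈ U) (hcx : c x = true) (hxu : G.AdjOn Set.univ x u)
    (hdis : ∀ i < n, d i ∉ U) (hn : n % 2 = 0) (hc : ∀ i < n, c (d i) = decide (i % 2 = 1))
    {j : ℕ} (hj : j < n) (hj1 : j % 2 = 1) :
    ∃ S', G.Good c (U ∪ d '' {i | i < n}) S' ((L \ {x}) ∪ {d j}) := by
  obtain ⟨S1, h1⟩ := hd.good_minus h hx hcx hxu hdis hn hc hj hj1
  obtain ⟨S2, h2⟩ := h1.pendant (x := d (j - 1)) (v := d j)
    (Or.inr ⟨j - 1, by simp only [Set.mem_ofPred_eq]; omega, rfl⟩)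
    (hd.notMem_minus hj (hdis j hj))
    (by have := hd.adjU (j - 1) (by omega); rwa [Nat.sub_add_cancel (by omega)] at this)
    (by
      rw [hc _ (by omega), hc _ (by omega)]
      simp only [ne_eq, decide_eq_decide]; omega)
  rw [union_minus U d n j hj] at h2
  refine ⟨S2, h2.mono ?_⟩
  rintro v - (⟨h3, -⟩ | h3) -
  · left; exact h3
  · right; exact h3

/-- attaching the vertex `d j`, recoloured, to a type 1 vertex `q` -/
lemma Cyc.good_conflict {F : Set E} {u : V} {n : ℕ} {d : ℕ → V} (hd : G.Cyc F u n d)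
    {c : V → Bool} {U : Set V} {S : Set E} {q : V} {j : ℕ}
    (h : G.Good c (U ∪ d '' {i | i < n ∧ i ≠ j}) S {q})
    (hj : j < n) (hdis : d j ∉ U) (hq : q ∈ U ∪ d '' {i | i < n ∧ i ≠ j}) (hcq : c q = true)
    (hadj : G.AdjOn Set.univ q (d j)) :
    ∃ S' c', (∀ v, v ≠ d j → c' v = c v) ∧ G.Good c' (U ∪ d '' {i | i < n}) S' ∅ := by
  classical
  have hnm := hd.notMem_minus hj hdis
  have hcc : ∀ v, v ≠ d j → Function.update c (d j) false v = c v :=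
    fun v hv => Function.update_of_ne hv _ _
  have h' := h.congr (c' := Function.update c (d j) false)
    (fun v hv => hcc v (fun h => hnm (h ▸ hv)))
  obtain ⟨S2, h2⟩ := h'.pendant hq hnm hadj
    (by rw [hcc q hadj.ne', hcq]; simp)
  rw [union_minus U d n j hj] at h2
  refine ⟨S2, _, hcc, h2.mono ?_⟩
  rintro v - (⟨h3, h4⟩ | h3) h5
  · exact absurd h3 h4
  · simp only [Set.mem_singleton_iff] at h3
    subst h3
    simp at h5

lemma count_le {S : Set E} {O I : Set V} (hdisj : ∀ v ∈ O, v ∉ I)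
    (hOI : ∀ a b, G.AdjOn S a b → a ∈ O → b ∈ I) (r : ℕ)
    (hrO : ∀ v ∈ O, G.degOn S v = r) (hrI : ∀ v ∈ I, G.degOn S v = r) :
    r * O.ncard ≤ r * I.ncard ∧ (r * I.ncard ≤ r * O.ncard →
      ∀ a b, G.AdjOn S a b → a ∈ I → b ∈ O) := by
  classical
  have key : ∀ A : Set V, (∀ v ∈ A, G.degOn S v = r) →
      r * A.ncard = ∑ e ∈ S.toFinset, (A.toFinset.filter (fun v => v ∈ G.inc e)).card := by
    intro A hA
    have h1 : ∀ v ∈ A.toFinset, (S.toFinset.filter (fun e => v ∈ G.inc e)).card = r := by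
      intro v hv
      rw [← hA v (by simpa using hv)]
      unfold degOn
      rw [Set.ncard_eq_toFinset_card']
      congr 1
      ext e; simp
    have h2 := Finset.sum_card_bipartiteAbove_eq_sum_card_bipartiteBelow
      (r := fun v e => v ∈ G.inc e) (s := A.toFinset) (t := S.toFinset)
    unfold Finset.bipartiteAbove Finset.bipartiteBelow at h2
    rw [← h2, Finset.sum_congr rfl (g := fun _ => r) h1]
    rw [Finset.sum_const, Set.ncard_eq_toFinset_card', smul_eq_mul, mul_comm]
  have hle : ∀ e ∈ S.toFinset, (O.toFinset.filter (fun v => v ∈ G.inc e)).card ≤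
      (I.toFinset.filter (fun v => v ∈ G.inc e)).card := by
    intro e he
    have heS : e ∈ S := by simpa using he
    obtain ⟨⟨a, b⟩, hab⟩ : ∃ p : V × V, G.inc e = s(p.1, p.2) := by
      induction h : G.inc e with
      | _ a b => exact ⟨(a, b), rfl⟩
    simp only at hab
    have h1 : a ∈ O → b ∈ I := hOI a b ⟨e, heS, hab⟩
    have h2 : b ∈ O → a ∈ I := hOI b a ⟨e, heS, by rw [hab, Sym2.eq_swap]⟩
    by_cases ha : a ∈ O
    · have hb : b ∉ O := fun hb => hdisj a ha (h2 hb)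
      have h3 : O.toFinset.filter (fun v => v ∈ G.inc e) ⊆ {a} := by
        intro v hv
        simp only [Finset.mem_filter, Set.mem_toFinset, hab, Sym2.mem_iff] at hv
        rcases hv with ⟨h4, rfl | rfl⟩
        · simp
        · exact absurd h4 hb
      refine (Finset.card_le_card h3).trans ?_
      rw [Finset.card_singleton]
      exact Finset.card_pos.2 ⟨b, by simp [hab, h1 ha]⟩
    · by_cases hb : b ∈ O
      · have h3 : O.toFinset.filter (fun v => v ∈ G.inc e) ⊆ {b} := by
          intro v hv
          simp only [Finset.mem_filter, Set.mem_toFinset, hab, Sym2.mem_iff] at hv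
          rcases hv with ⟨h4, rfl | rfl⟩
          · exact absurd h4 ha
          · simp
        refine (Finset.card_le_card h3).trans ?_
        rw [Finset.card_singleton]
        exact Finset.card_pos.2 ⟨a, by simp [hab, h2 hb]⟩
      · have h3 : O.toFinset.filter (fun v => v ∈ G.inc e) = ∅ := by
          ext v
          simp only [Finset.mem_filter, Set.mem_toFinset, hab, Sym2.mem_iff]
          constructor
          · rintro ⟨h4, rfl | rfl⟩
            · exact absurd h4 ha
            · exact absurd h4 hb
          · simp
        rw [h3]; simp
  rw [key O hrO, key I hrI]
  refine ⟨Finset.sum_le_sum hle, ?_⟩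
  rintro hge a b ⟨e, heS, hab⟩ haI
  have heq := (Finset.sum_eq_sum_iff_of_le hle).1 (le_antisymm (Finset.sum_le_sum hle) hge) e
    (by simpa using heS)
  have hpos : 0 < (I.toFinset.filter (fun v => v ∈ G.inc e)).card :=
    Finset.card_pos.2 ⟨a, by simp [hab, haI]⟩
  rw [← heq] at hpos
  obtain ⟨v, hv⟩ := Finset.card_pos.1 hpos
  simp only [Finset.mem_filter, Set.mem_toFinset, hab, Sym2.mem_iff] at hv
  rcases hv with ⟨h4, rfl | rfl⟩
  · exact absurd haI (hdisj _ h4)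
  · exact h4

/-- colour alternation along an `F`-cycle -/
lemma Cyc.alt {F : Set E} {u : V} {n : ℕ} {d : ℕ → V} (hd : G.Cyc F u n d) {c : V → Bool}
    (hc : ∀ i < n, ∀ b, G.AdjOn F (d i) b → c (d i) ≠ c b) :
    (∀ i < n, c (d i) = (c u ^^ decide (i % 2 = 1))) ∧ n % 2 = 0 := by
  have hn2 := hd.two
  have h1 : ∀ i < n, c (d i) = (c u ^^ decide (i % 2 = 1)) := by
    intro i hi
    induction i with
    | zero => simp [hd.zero]
    | succ i ih =>
      have h2 := hc i (by omega) _ (hd.adj i hi)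
      rw [ih (by omega)] at h2
      have h3 : decide ((i + 1) % 2 = 1) = !decide (i % 2 = 1) := by
        rw [← decide_not, decide_eq_decide]; omega
      rw [h3]
      revert h2
      cases c u <;> cases decide (i % 2 = 1) <;> cases c (d (i + 1)) <;> simp
  refine ⟨h1, ?_⟩
  have h2 := hc (n - 1) (by omega) _ hd.wrap
  rw [h1 _ (by omega), hd.zero] at h2
  by_contra h3
  apply h2
  have : decide ((n - 1) % 2 = 1) = false := by
    rw [decide_eq_false_iff_not]; omega
  rw [this]; simp

lemma Cyc.proper {F : Set E} {u : V} {n : ℕ} {d : ℕ → V} (hd : G.Cyc F u n d) {c : V → Bool}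
    {t : Bool} (hc : ∀ i < n, c (d i) = (t ^^ decide (i % 2 = 1))) (hn : n % 2 = 0) :
    ∀ i < n, ∀ b, G.AdjOn F (d i) b → c (d i) ≠ c b := by
  intro i hi b hab
  obtain ⟨j, hj, rfl, h⟩ := hd.nbr i hi b hab
  rw [hc i hi, hc j hj]
  have hn2 := hd.two
  have : ¬ ((i % 2 = 1) ↔ (j % 2 = 1)) := by omega
  intro h2
  apply this
  have h3 : decide (i % 2 = 1) = decide (j % 2 = 1) := by
    revert h2
    cases t <;> simp
  exact decide_eq_decide.1 h3

/-- An even tree on an `F`-closed set strictly larger than `B`. -/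
def Success (G : Multigraph V E) (F : Set E) (w : V) (lam : Bool) (B : Set V) : Prop :=
  ∃ U S c, B ⊆ U ∧ (∃ v ∈ U, v ∉ B) ∧ G.FClosed F U ∧ w ∈ U ∧ c w = lam ∧ G.Good c U S ∅

structure State (G : Multigraph V E) (F : Set E) (w : V) (lam : Bool) (B R Z : Set V)
    (c : V → Bool) : Prop where
  closedR : G.FClosed F R
  closedZ : G.FClosed F Z
  properZ : ∀ a ∈ Z, ∀ b, G.AdjOn F a b → c a ≠ c b
  ZR : Z ⊆ R
  BR : B ⊆ R
  wR : w ∈ R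
  cw : c w = lam
  pair : ∀ p ∈ R, ∀ q ∈ R, c p = true → c q = true → ∃ U S, B ⊆ U ∧ U ⊆ R ∧ G.FClosed F U ∧
    w ∈ U ∧ p ∈ U ∧ q ∈ U ∧ G.Good c U S {p, q}
  hZ : ∀ y ∈ Z, c y = true → ∀ z ∈ R, G.AdjOn Set.univ y z → z ∈ Z ∧ c z = false
  hX : ∀ x ∈ R, x ∉ Z → c x = false → ∀ z, z ∉ R → ¬ G.AdjOn Set.univ x z
  ne : Z.Nonempty ∨ R ≠ Set.univ

lemma closed_univ (hconn : G.Connected) {A : Set V} (hA : A.Nonempty)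
    (h : ∀ a b, G.AdjOn Set.univ a b → a ∈ A → b ∈ A) : A = Set.univ := by
  obtain ⟨a, ha⟩ := hA
  ext b
  simp only [Set.mem_univ, iff_true]
  have := hconn.2 a b
  induction this with
  | refl => exact ha
  | tail _ h1 ih => exact h _ _ h1 ih

lemma State.exit (hreg : G.IsRegular) (hnb : ¬ G.IsBipartite) (hconn : G.Connected)
    {F : Set E} (hF : ∀ v, G.degOn F v = 2) {w : V} {lam : Bool} {B R Z : Set V} {c : V → Bool}
    (h : G.State F w lam B R Z c) :
    ∃ y ∈ R, c y = true ∧ ∃ u, u ∉ R ∧ G.AdjOn Set.univ y u := by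
  by_contra hno
  push Not at hno
  by_cases hZ : Z.Nonempty
  · obtain ⟨r, hr⟩ := hreg
    let O : Set V := {v | v ∈ Z ∧ c v = true}
    let I : Set V := {v | v ∈ Z ∧ c v = false}
    have hO : ∀ v, v ∈ O ↔ v ∈ Z ∧ c v = true := fun v => Iff.rfl
    have hI : ∀ v, v ∈ I ↔ v ∈ Z ∧ c v = false := fun v => Iff.rfl
    have hd1 : ∀ v ∈ O, v ∉ I := by
      intro v h1 h2
      have h1 := (hO v).1 h1
      have h2 := (hI v).1 h2
      simp [h1.2] at h2
    have hd2 : ∀ v ∈ I, v ∉ O := fun v h1 h2 => hd1 v h2 h1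
    have e1 := (count_le (G := G) (S := F) hd1 (by
      intro a b hab ha
      rw [hO] at ha; rw [hI]
      have := h.properZ a ha.1 b hab
      exact ⟨h.closedZ _ _ hab ha.1, by simpa [ha.2] using this.symm⟩) 2
      (fun v _ => hF v) (fun v _ => hF v)).1
    have e2 := (count_le (G := G) (S := F) hd2 (by
      intro a b hab ha
      rw [hI] at ha; rw [hO]
      have := h.properZ a ha.1 b hab
      exact ⟨h.closedZ _ _ hab ha.1, by simpa [ha.2] using this.symm⟩) 2
      (fun v _ => hF v) (fun v _ => hF v)).1
    have hcard : O.ncard = I.ncard := by omega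
    have hOI : ∀ a b, G.AdjOn Set.univ a b → a ∈ O → b ∈ I := by
      intro a b hab ha
      rw [hO] at ha; rw [hI]
      by_cases hb : b ∈ R
      · exact h.hZ a ha.1 ha.2 b hb hab
      · exact absurd hab (hno a (h.ZR ha.1) ha.2 b hb)
    have hOfI := (count_le (G := G) (S := Set.univ) hd1 hOI r
      (fun v _ => hr v) (fun v _ => hr v)).2 (by rw [hcard])
    have hcases : ∀ v ∈ Z, v ∈ O ∨ v ∈ I := by
      intro v hv
      rw [hO, hI]
      cases c v <;> simp [hv]
    have huniv : Z = Set.univ := by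
      apply closed_univ hconn hZ
      intro a b hab ha
      rcases hcases a ha with h1 | h1
      · exact ((hI b).1 (hOI a b hab h1)).1
      · exact ((hO b).1 (hOfI a b hab h1)).1
    apply hnb
    refine ⟨c, ?_⟩
    intro e he a b hab
    have hab' : G.AdjOn Set.univ a b := ⟨e, he, hab⟩
    rcases hcases a (by rw [huniv]; trivial) with h1 | h1
    · rw [((hO a).1 h1).2, ((hI b).1 (hOI a b hab' h1)).2]; simp
    · rw [((hI a).1 h1).2, ((hO b).1 (hOfI a b hab' h1)).2]; simp
  · have hR : R ≠ Set.univ := h.ne.resolve_left hZ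
    apply hR
    apply closed_univ hconn ⟨w, h.wR⟩
    intro a b hab ha
    by_contra hb
    cases hca : c a
    · exact h.hX a ha (fun h1 => hZ ⟨a, h1⟩) hca b hb hab
    · exact hno a ha hca b hb hab

lemma State.success (hreg : G.IsRegular) (hnb : ¬ G.IsBipartite) (hconn : G.Connected)
    {F : Set E} (hF : ∀ v, G.degOn F v = 2) {w : V} {lam : Bool} {B : Set V} (k : ℕ) :
    ∀ {R Z : Set V} {c : V → Bool}, Rᶜ.ncard ≤ k → G.State F w lam B R Z c →
      G.Success F w lam B := by
  induction k with
  | zero =>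
    intro R Z c hk h
    obtain ⟨y, hy, hcy, u, hu, hyu⟩ := h.exit hreg hnb hconn hF
    have : Rᶜ = ∅ := (Set.ncard_eq_zero (Set.toFinite _)).1 (by omega)
    have hu' : u ∈ Rᶜ := hu
    rw [this] at hu'
    exact absurd hu' (Set.notMem_empty u)
  | succ k ih =>
    intro R Z c hk h
    obtain ⟨y, hy, hcy, u, hu, hyu⟩ := h.exit hreg hnb hconn hF
    obtain ⟨n, d, hd⟩ := exists_cyc hF u
    have hn2 := hd.two
    have hdR := hd.disj h.closedR hu
    obtain ⟨c', hc'1, hc'2⟩ := hd.recolor c (fun i => decide (i % 2 = 1))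
    have hcR : ∀ v ∈ R, c' v = c v := fun v hv => hc'1 v (fun i hi h1 => hdR i hi (h1 ▸ hv))
    have huD : u ∈ d '' {i | i < n} := ⟨0, by simp only [Set.mem_ofPred_eq]; omega, hd.zero⟩
    have hDR : ∀ v ∈ d '' {i | i < n}, v ∉ R := by
      rintro v ⟨i, hi, rfl⟩; exact hdR i hi
    have hcy' : c' y = true := by rw [hcR y hy, hcy]
    have hcw' : c' w = lam := by rw [hcR w h.wR, h.cw]
    rcases Nat.mod_two_eq_zero_or_one n with hn | hn
    · -- even cycle
      by_cases hconf : ∃ j < n, j % 2 = 1 ∧ ∃ q ∈ R ∪ d '' {i | i < n}, c' q = true ∧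
          G.AdjOn Set.univ q (d j)
      · obtain ⟨j, hj, hj1, q, hq, hcq, hqj⟩ := hconf
        have hqne : q ≠ d j := hqj.ne'
        obtain ⟨U, S, hBU, hUR, hUF, hwU, hqU, hgood⟩ : ∃ U S, B ⊆ U ∧ U ⊆ R ∧ G.FClosed F U ∧
            w ∈ U ∧ q ∈ U ∪ d '' {i | i < n ∧ i ≠ j} ∧
            G.Good c' (U ∪ d '' {i | i < n ∧ i ≠ j}) S {q} := by
          rcases hq with hq | ⟨l, hl, rfl⟩
          · obtain ⟨U, S, hBU, hUR, hUF, hwU, hyU, hqU, hgood⟩ :=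
              h.pair y hy q hq hcy (by rw [← hcR q hq]; exact hcq)
            obtain ⟨S', hS'⟩ := hd.good_minus (hgood.congr (fun v hv => hcR v (hUR hv))) hyU hcy'
              hyu (fun i hi h1 => hdR i hi (hUR h1)) hn hc'2 hj hj1
            refine ⟨U, S', hBU, hUR, hUF, hwU, Or.inl hqU, hS'.mono ?_⟩
            rintro v - ⟨h1 | h1, h2⟩ -
            · exact absurd h1 h2
            · exact h1
          · obtain ⟨U, S, hBU, hUR, hUF, hwU, hyU, -, hgood⟩ := h.pair y hy y hy hcy hcy
            obtain ⟨S', hS'⟩ := hd.good_minus (hgood.congr (fun v hv => hcR v (hUR hv))) hyU hcy'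
              hyu (fun i hi h1 => hdR i hi (hUR h1)) hn hc'2 hj hj1
            refine ⟨U, S', hBU, hUR, hUF, hwU,
              Or.inr ⟨l, ⟨hl, fun h1 => hqne (by rw [h1])⟩, rfl⟩, hS'.mono ?_⟩
            rintro v - ⟨h1 | h1, h2⟩ -
            · exact absurd h1 h2
            · exact absurd h1 h2
        obtain ⟨S', c'', hc'', hg⟩ := hd.good_conflict hgood hj (fun h1 => hdR j hj (hUR h1))
          hqU hcq hqj
        refine ⟨_, S', c'', hBU.trans Set.subset_union_left, ⟨u, Or.inr huD, fun h1 => hu (h.BR h1)⟩,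
          hUF.union hd.closed, Or.inl hwU, ?_, hg⟩
        rw [hc'' w (fun h1 => hdR j hj (h1 ▸ h.wR)), hcw']
      · have hnc : ∀ z ∈ d '' {i | i < n}, c' z = true → ∀ q ∈ R ∪ d '' {i | i < n},
            G.AdjOn Set.univ z q → c' q = false := by
          rintro z ⟨j, hj, rfl⟩ hcz q hq hzq
          by_contra hcq
          apply hconf
          refine ⟨j, hj, ?_, q, hq, by simpa using hcq, hzq.symm'⟩
          rw [hc'2 j hj] at hcz
          simpa using hcz
        have hpairD : ∀ p ∈ d '' {i | i < n}, ∀ q ∈ R ∪ d '' {i | i < n}, c' p = true →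
            c' q = true → ∃ U S, B ⊆ U ∧ U ⊆ R ∪ d '' {i | i < n} ∧ G.FClosed F U ∧
            w ∈ U ∧ p ∈ U ∧ q ∈ U ∧ G.Good c' U S {p, q} := by
          rintro p ⟨j, hj, rfl⟩ q hq hcp hcq
          have hj1 : j % 2 = 1 := by
            rw [hc'2 j hj] at hcp
            simpa using hcp
          obtain ⟨q0, hq0, hcq0, hqq⟩ : ∃ q0 ∈ R, c q0 = true ∧
              ((q = q0) ∨ (q ∈ d '' {i | i < n} ∧ q0 = y)) := by
            rcases hq with hq | hq
            · exact ⟨q, hq, by rw [← hcR q hq]; exact hcq, Or.inl rfl⟩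
            · exact ⟨y, hy, hcy, Or.inr ⟨hq, rfl⟩⟩
          obtain ⟨U, S, hBU, hUR, hUF, hwU, hyU, hqU, hgood⟩ := h.pair y hy q0 hq0 hcy hcq0
          obtain ⟨S', hS'⟩ := hd.good_add (hgood.congr (fun v hv => hcR v (hUR hv))) hyU hcy'
              hyu (fun i hi h1 => hdR i hi (hUR h1)) hn hc'2 hj hj1
          refine ⟨_, S', hBU.trans Set.subset_union_left, Set.union_subset_union_left _ hUR,
            hUF.union hd.closed, Or.inl hwU, Or.inr ⟨j, hj, rfl⟩, ?_, hS'.mono ?_⟩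
          · rcases hqq with rfl | ⟨h1, -⟩
            · left; exact hqU
            · right; exact h1
          · rintro v - (⟨h1 | h1, h2⟩ | h1) -
            · exact absurd h1 h2
            · rcases hqq with h3 | ⟨-, h3⟩
              · right; rw [h3]; exact h1
              · rw [h3] at h1; exact absurd h1 h2
            · left; exact h1
        apply ih (R := R ∪ d '' {i | i < n}) (Z := Z ∪ d '' {i | i < n}) (c := c')
        · have : (R ∪ d '' {i | i < n})ᶜ.ncard < Rᶜ.ncard := by
            apply Set.ncard_lt_ncard _ (Set.toFinite _)
            refine ⟨Set.compl_subset_compl.2 Set.subset_union_left, fun h1 => ?_⟩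
            exact h1 (show u ∈ Rᶜ from hu) (Or.inr huD)
          omega
        · refine ⟨h.closedR.union hd.closed, h.closedZ.union hd.closed, ?_,
            Set.union_subset_union_left _ h.ZR, h.BR.trans Set.subset_union_left, Or.inl h.wR,
            hcw', ?_, ?_, ?_, Or.inl ⟨u, Or.inr huD⟩⟩
          · rintro a (ha | ⟨i, hi, rfl⟩) b hab
            · rw [hcR a (h.ZR ha), hcR b (h.ZR (h.closedZ _ _ hab ha))]
              exact h.properZ a ha b hab
            · exact hd.proper (t := false) (by simpa using hc'2) hn i hi b hab
          · rintro p hp q hq hcp hcq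
            by_cases hpD : p ∈ d '' {i | i < n}
            · exact hpairD p hpD q hq hcp hcq
            by_cases hqD : q ∈ d '' {i | i < n}
            · obtain ⟨U, S, h1, h2, h3, h4, h5, h6, h7⟩ := hpairD q hqD p hp hcq hcp
              exact ⟨U, S, h1, h2, h3, h4, h6, h5, by rw [Set.pair_comm]; exact h7⟩
            have hp := hp.resolve_right hpD
            have hq := hq.resolve_right hqD
            obtain ⟨U, S, h1, h2, h3, h4, h5, h6, h7⟩ := h.pair p hp q hq
              (by rw [← hcR p hp]; exact hcp) (by rw [← hcR q hq]; exact hcq)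
            exact ⟨U, S, h1, h2.trans Set.subset_union_left, h3, h4, h5, h6,
              h7.congr (fun v hv => hcR v (h2 hv))⟩
          · intro a ha hca z hz haz
            rcases ha with ha | ha
            · have hca' : c a = true := by rw [← hcR a (h.ZR ha)]; exact hca
              rcases hz with hz | hz
              · have := h.hZ a ha hca' z hz haz
                exact ⟨Or.inl this.1, by rw [hcR z hz]; exact this.2⟩
              · refine ⟨Or.inr hz, ?_⟩
                by_contra hcz
                have := hnc z hz (by simpa using hcz) a (Or.inl (h.ZR ha)) haz.symm'
                rw [this] at hca; simp at hca
            · have hcz := hnc a ha hca z hz haz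
              refine ⟨?_, hcz⟩
              rcases hz with hz | hz
              · left
                by_contra hzZ
                exact h.hX z hz hzZ (by rw [← hcR z hz]; exact hcz) a (hDR a ha) haz.symm'
              · right; exact hz
          · intro x hx hxZ hcx z hz
            have hxR : x ∈ R := by
              rcases hx with hx | hx
              · exact hx
              · exact absurd (Or.inr hx) hxZ
            exact h.hX x hxR (fun h1 => hxZ (Or.inl h1)) (by rw [← hcR x hxR]; exact hcx) z
              (fun h1 => hz (Or.inl h1))
    · -- odd cycle
      obtain ⟨U, S, hBU, hUR, hUF, hwU, hyU, -, hgood⟩ := h.pair y hy y hy hcy hcy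
      obtain ⟨S', hS'⟩ := (hgood.congr (fun v hv => hcR v (hUR hv))).addPath hyU d n (by omega)
        (by rw [hd.zero]; exact hyu) (fun i hi => hd.adjU i hi) hd.inj
        (fun i hi h1 => hdR i hi (hUR h1)) (by rw [hcy', hc'2 0 (by omega)]; simp)
        (fun i hi => by
          rw [hc'2 i (by omega), hc'2 (i + 1) (by omega)]
          simp only [ne_eq, decide_eq_decide]; omega)
        (by rw [hc'2 _ (by omega)]; simp only [decide_eq_false_iff_not]; omega)
      refine ⟨_, S', c', hBU.trans Set.subset_union_left, ⟨u, Or.inr huD, fun h1 => hu (h.BR h1)⟩,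
        hUF.union hd.closed, Or.inl hwU, hcw', hS'.mono ?_⟩
      rintro v - ⟨h1 | h1, h2⟩ -
      · exact absurd h1 h2
      · exact absurd h1 h2


/-- The set obtained by a path around the cycle. -/
lemma image_shift (d : ℕ → V) (n a : ℕ) (ha : a ≤ n) :
    (fun i => d (i + a)) '' {i | i < n - a} = d '' {i | i < n ∧ a ≤ i} := by
  ext v
  constructor
  · rintro ⟨i, hi, rfl⟩
    simp only [Set.mem_ofPred_eq] at hi
    exact ⟨i + a, by simp only [Set.mem_ofPred_eq]; omega, rfl⟩
  · rintro ⟨i, hi, rfl⟩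
    simp only [Set.mem_ofPred_eq] at hi
    exact ⟨i - a, by simp only [Set.mem_ofPred_eq]; omega, by
      simp only; rw [Nat.sub_add_cancel hi.2]⟩

lemma Cyc.seed_odd {F : Set E} {w : V} {n : ℕ} {d : ℕ → V} (hd : G.Cyc F w n d)
    (hn : n % 2 = 1) (lam : Bool) :
    ∃ S c, c w = lam ∧ G.Good c (d '' {i | i < n}) S ∅ := by
  have hn2 := hd.two
  cases lam
  · obtain ⟨c, -, hc⟩ := hd.recolor (fun _ => false) (fun i => decide (i % 2 = 1))
    have hc0 : c (d 0) = false := by rw [hc 0 (by omega)]; simp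
    obtain ⟨S, hS⟩ := (Good.single (G := G) c (d 0) hc0 ∅).addPath (x := d 0) rfl
      (fun i => d (i + 1)) (n - 1) (by omega) (hd.adjU 0 (by omega))
      (fun i hi => hd.adjU (i + 1) (by omega))
      (fun i hi j hj h => by have := hd.inj _ (by omega) _ (by omega) h; omega)
      (fun i hi h => by have := hd.inj _ (by omega) _ (by omega) h; omega)
      (by rw [hc0, hc _ (by omega)]; simp)
      (fun i hi => by
        rw [hc _ (by omega), hc _ (by omega)]
        simp only [ne_eq, decide_eq_decide]; omega)
      (by rw [hc _ (by omega)]; simp only [decide_eq_false_iff_not]; omega)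
    refine ⟨S, c, by rw [← hd.zero, hc0], ?_⟩
    rw [image_shift d n 1 (by omega)] at hS
    have : {d 0} ∪ d '' {i | i < n ∧ 1 ≤ i} = d '' {i | i < n} := by
      ext v
      constructor
      · rintro (rfl | ⟨i, hi, rfl⟩)
        · exact ⟨0, by simp only [Set.mem_ofPred_eq]; omega, rfl⟩
        · exact ⟨i, hi.1, rfl⟩
      · rintro ⟨i, hi, rfl⟩
        rcases Nat.eq_zero_or_pos i with rfl | h
        · left; rfl
        · right; exact ⟨i, ⟨hi, h⟩, rfl⟩
    rw [this] at hS
    exact hS.mono (fun v _ h _ => h.1)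
  · obtain ⟨c, -, hc⟩ := hd.recolor (fun _ => false) (fun i => decide (i % 2 = 0 ∧ i ≠ n - 1))
    have hcl : c (d (n - 1)) = false := by rw [hc _ (by omega)]; simp
    obtain ⟨S, hS⟩ := (Good.single (G := G) c (d (n - 1)) hcl ∅).addPath (x := d (n - 1)) rfl
      d (n - 1) (by omega) (hd.wrap.mono' (Set.subset_univ _))
      (fun i hi => hd.adjU i (by omega))
      (fun i hi j hj h => hd.inj _ (by omega) _ (by omega) h)
      (fun i hi h => by have := hd.inj _ (by omega) _ (by omega) h; omega)
      (by rw [hcl, hc _ (by omega)]; simp; omega)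
      (fun i hi => by
        rw [hc _ (by omega), hc _ (by omega)]
        simp only [ne_eq, decide_eq_decide]; omega)
      (by rw [hc _ (by omega)]; simp only [decide_eq_false_iff_not]; omega)
    refine ⟨S, c, by rw [← hd.zero, hc 0 (by omega)]; simp; omega, ?_⟩
    have : {d (n - 1)} ∪ d '' {i | i < n - 1} = d '' {i | i < n} := by
      ext v
      constructor
      · rintro (rfl | ⟨i, hi, rfl⟩)
        · exact ⟨n - 1, by simp only [Set.mem_ofPred_eq]; omega, rfl⟩
        · simp only [Set.mem_ofPred_eq] at hi
          exact ⟨i, by simp only [Set.mem_ofPred_eq]; omega, rfl⟩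
      · rintro ⟨i, hi, rfl⟩
        simp only [Set.mem_ofPred_eq] at hi
        by_cases h : i = n - 1
        · left; rw [h]; rfl
        · right; exact ⟨i, by simp only [Set.mem_ofPred_eq]; omega, rfl⟩
    rw [this] at hS
    exact hS.mono (fun v _ h _ => h.1)

lemma Cyc.seed_minus {F : Set E} {p : V} {n : ℕ} {d : ℕ → V} (hd : G.Cyc F p n d)
    {c : V → Bool} (hc : ∀ i < n, c (d i) = (true ^^ decide (i % 2 = 1))) (hn : n % 2 = 0) :
    ∃ S, G.Good c (∅ ∪ d '' {i | i < n ∧ i ≠ 0}) S ∅ := by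
  have hn2 := hd.two
  have hc' : ∀ i < n, c (d i) = decide (i % 2 = 0) := by
    intro i hi
    rw [hc i hi, Bool.true_xor, ← decide_not, decide_eq_decide]; omega
  have hc1 : c (d 1) = false := by rw [hc' 1 (by omega)]; simp
  obtain ⟨S, hS⟩ := (Good.single (G := G) c (d 1) hc1 ∅).addPath0 (x := d 1) rfl
    (fun i => d (i + 2)) (n - 2) (fun h => hd.adjU 1 (by omega))
    (fun i hi => hd.adjU (i + 2) (by omega))
    (fun i hi j hj h => by have := hd.inj _ (by omega) _ (by omega) h; omega)
    (fun i hi h => by have := hd.inj _ (by omega) _ (by omega) h; omega)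
    (fun h => by rw [hc1, hc' _ (by omega)]; simp)
    (fun i hi => by
      rw [hc' _ (by omega), hc' _ (by omega)]
      simp only [ne_eq, decide_eq_decide]; omega)
    (fun h => by rw [hc' _ (by omega)]; simp only [decide_eq_false_iff_not]; omega)
  refine ⟨S, ?_⟩
  rw [image_shift d n 2 (by omega)] at hS
  have : {d 1} ∪ d '' {i | i < n ∧ 2 ≤ i} = ∅ ∪ d '' {i | i < n ∧ i ≠ 0} := by
    ext v
    constructor
    · rintro (rfl | ⟨i, hi, rfl⟩)
      · exact Or.inr ⟨1, by simp only [Set.mem_ofPred_eq]; omega, rfl⟩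
      · simp only [Set.mem_ofPred_eq] at hi
        exact Or.inr ⟨i, by simp only [Set.mem_ofPred_eq]; omega, rfl⟩
    · rintro (h | ⟨i, hi, rfl⟩)
      · exact absurd h (Set.notMem_empty _)
      · simp only [Set.mem_ofPred_eq] at hi
        by_cases h : i = 1
        · left; rw [h]; rfl
        · right; exact ⟨i, by simp only [Set.mem_ofPred_eq]; omega, rfl⟩
  rw [this] at hS
  exact hS

lemma Cyc.image_eq {F : Set E} {u v : V} {n m : ℕ} {d e : ℕ → V} (hd : G.Cyc F u n d)
    (he : G.Cyc F v m e) (hv : v ∈ d '' {i | i < n}) :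
    e '' {i | i < m} = d '' {i | i < n} := by
  have hm := he.two
  apply Set.Subset.antisymm
  · rintro _ ⟨i, hi, rfl⟩
    exact he.all_mem hd.closed (k := 0) (by omega) (by rw [he.zero]; exact hv) i hi
  · rintro _ ⟨i, hi, rfl⟩
    obtain ⟨k, hk, rfl⟩ := hv
    exact hd.all_mem he.closed hk ⟨0, by simp only [Set.mem_ofPred_eq]; omega, he.zero⟩ i hi

lemma seed (hreg : G.IsRegular) (hnb : ¬ G.IsBipartite) (hconn : G.Connected)
    {F : Set E} (hF : ∀ v, G.degOn F v = 2) (w : V) (lam : Bool) : G.Success F w lam ∅ := by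
  obtain ⟨n, d, hd⟩ := exists_cyc hF w
  have hn2 := hd.two
  have hwD : w ∈ d '' {i | i < n} := ⟨0, by simp only [Set.mem_ofPred_eq]; omega, hd.zero⟩
  rcases Nat.mod_two_eq_zero_or_one n with hn | hn
  · obtain ⟨c, -, hc⟩ := hd.recolor (fun _ => false) (fun i => lam ^^ decide (i % 2 = 1))
    have hprop := hd.proper hc hn
    have hcw : c w = lam := by rw [← hd.zero, hc 0 (by omega)]; simp
    have key : ∀ p ∈ d '' {i | i < n}, c p = true → ∃ m e, G.Cyc F p m e ∧
        e '' {i | i < m} = d '' {i | i < n} ∧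
        (∀ i < m, c (e i) = (true ^^ decide (i % 2 = 1))) ∧ m % 2 = 0 := by
      intro p hp hcp
      obtain ⟨m, e, he⟩ := exists_cyc hF p
      have him := hd.image_eq he hp
      have := he.alt (c := c) (by
        intro i hi b hb
        have : e i ∈ d '' {i | i < n} := by rw [← him]; exact ⟨i, hi, rfl⟩
        obtain ⟨k, hk, hke⟩ := this
        rw [← hke] at hb ⊢
        exact hprop k hk b hb)
      rw [hcp] at this
      exact ⟨m, e, he, him, this.1, this.2⟩
    by_cases hch : ∃ p ∈ d '' {i | i < n}, ∃ q ∈ d '' {i | i < n}, c p = true ∧ c q = true ∧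
        G.AdjOn Set.univ p q
    · obtain ⟨p, hp, q, hq, hcp, hcq, hpq, hpw⟩ : ∃ p ∈ d '' {i | i < n},
          ∃ q ∈ d '' {i | i < n}, c p = true ∧ c q = true ∧ G.AdjOn Set.univ p q ∧ p ≠ w := by
        obtain ⟨p, hp, q, hq, hcp, hcq, hpq⟩ := hch
        by_cases h : p = w
        · exact ⟨q, hq, p, hp, hcq, hcp, hpq.symm', fun h' => hpq.ne' (h.trans h'.symm)⟩
        · exact ⟨p, hp, q, hq, hcp, hcq, hpq, h⟩
      obtain ⟨m, e, he, him, hce, hm⟩ := key p hp hcp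
      have hm2 := he.two
      obtain ⟨S, hS⟩ := he.seed_minus hce hm
      have hqe : q ∈ ∅ ∪ e '' {i | i < m ∧ i ≠ 0} := by
        rw [← him] at hq
        obtain ⟨i, hi, rfl⟩ := hq
        refine Or.inr ⟨i, ⟨hi, ?_⟩, rfl⟩
        rintro rfl
        exact hpq.ne' he.zero.symm
      obtain ⟨S', c', hc', hg⟩ := he.good_conflict (j := 0) (q := q)
        (hS.mono (fun v _ h _ => absurd h (Set.notMem_empty _))) (by omega)
        (Set.notMem_empty _) hqe hcq (by rw [he.zero]; exact hpq.symm')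
      rw [him, Set.empty_union] at hg
      refine ⟨_, S', c', Set.empty_subset _, ⟨w, hwD, Set.notMem_empty _⟩, hd.closed, hwD, ?_, hg⟩
      rw [hc' w (by rw [he.zero]; exact hpw.symm), hcw]
    · apply State.success hreg hnb hconn hF _ (R := d '' {i | i < n}) (Z := d '' {i | i < n})
        (c := c) le_rfl
      refine ⟨hd.closed, hd.closed, ?_, Set.Subset.rfl, Set.empty_subset _, hwD, hcw, ?_, ?_, ?_,
        Or.inl ⟨w, hwD⟩⟩
      · rintro a ⟨i, hi, rfl⟩ b hab
        exact hprop i hi b hab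
      · intro p hp q hq hcp hcq
        obtain ⟨m, e, he, him, hce, hm⟩ := key p hp hcp
        have hm2 := he.two
        obtain ⟨S, hS⟩ := he.seed_minus hce hm
        obtain ⟨S', hS'⟩ := hS.pendant (x := e 1) (v := e 0)
          (Or.inr ⟨1, by simp only [Set.mem_ofPred_eq]; omega, rfl⟩)
          (he.notMem_minus (by omega) (Set.notMem_empty _)) (he.adjU 0 (by omega)).symm'
          (by rw [hce 1 (by omega), hce 0 (by omega)]; simp)
        rw [union_minus ∅ e m 0 (by omega), him, Set.empty_union, he.zero] at hS'
        refine ⟨_, S', Set.empty_subset _, Set.Subset.rfl, hd.closed, hwD, hp, hq, hS'.mono ?_⟩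
        rintro v - (h | h) -
        · exact absurd h.1 (Set.notMem_empty _)
        · left; exact h
      · intro y hy hcy z hz hyz
        refine ⟨hz, ?_⟩
        by_contra hcz
        exact hch ⟨y, hy, z, hz, hcy, by simpa using hcz, hyz⟩
      · intro x hx hx'
        exact absurd hx hx'
  · obtain ⟨S, c, hcw, hg⟩ := hd.seed_odd hn lam
    exact ⟨_, S, c, Set.empty_subset _, ⟨w, hwD, Set.notMem_empty _⟩, hd.closed, hwD, hcw, hg⟩

lemma extend (hreg : G.IsRegular) (hnb : ¬ G.IsBipartite) (hconn : G.Connected)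
    {F : Set E} (hF : ∀ v, G.degOn F v = 2) {w : V} {lam : Bool} {U : Set V} {S : Set E}
    {c : V → Bool} (hU : G.FClosed F U) (hw : w ∈ U) (hcw : c w = lam) (hg : G.Good c U S ∅)
    (hne : U ≠ Set.univ) : G.Success F w lam U := by
  by_cases hex : ∃ x ∈ U, c x = false ∧ ∃ u, u ∉ U ∧ G.AdjOn Set.univ x u
  · obtain ⟨x, hx, hcx, u, hu, hxu⟩ := hex
    obtain ⟨n, d, hd⟩ := exists_cyc hF u
    have hn2 := hd.two
    have hdU := hd.disj hU hu
    have huD : u ∈ d '' {i | i < n} := ⟨0, by simp only [Set.mem_ofPred_eq]; omega, hd.zero⟩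
    rcases Nat.mod_two_eq_zero_or_one n with hn | hn
    · obtain ⟨c', hc1, hc⟩ := hd.recolor c (fun i => decide (i % 2 = 0))
      have hcU : ∀ v ∈ U, c' v = c v := fun v hv => hc1 v (fun i hi h1 => hdU i hi (h1 ▸ hv))
      obtain ⟨S', hS'⟩ := (hg.congr hcU).addPath hx d n (by omega)
        (by rw [hd.zero]; exact hxu) (fun i hi => hd.adjU i hi) hd.inj hdU
        (by rw [hcU x hx, hcx, hc _ (by omega)]; simp)
        (fun i hi => by
          rw [hc _ (by omega), hc _ (by omega)]
          simp only [ne_eq, decide_eq_decide]; omega)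
        (by rw [hc _ (by omega)]; simp only [decide_eq_false_iff_not]; omega)
      exact ⟨_, S', c', Set.subset_union_left, ⟨u, Or.inr huD, hu⟩, hU.union hd.closed,
        Or.inl hw, by rw [hcU w hw, hcw], hS'.mono (fun v _ h _ => h.1)⟩
    · obtain ⟨c', hc1, hc⟩ := hd.recolor c (fun i => decide (i % 2 = 0 ∧ i ≠ n - 1))
      have hcU : ∀ v ∈ U, c' v = c v := fun v hv => hc1 v (fun i hi h1 => hdU i hi (h1 ▸ hv))
      obtain ⟨S1, hS1⟩ := (hg.congr hcU).addPath hx d (n - 1) (by omega)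
        (by rw [hd.zero]; exact hxu) (fun i hi => hd.adjU i (by omega))
        (fun i hi j hj => hd.inj i (by omega) j (by omega)) (fun i hi => hdU i (by omega))
        (by rw [hcU x hx, hcx, hc _ (by omega)]; simp; omega)
        (fun i hi => by
          rw [hc _ (by omega), hc _ (by omega)]
          simp only [ne_eq, decide_eq_decide]; omega)
        (by rw [hc _ (by omega)]; simp only [decide_eq_false_iff_not]; omega)
      have hset : d '' {i | i < n - 1} = d '' {i | i < n ∧ i ≠ n - 1} := by
        congr 1; ext i; simp only [Set.mem_ofPred_eq]; omega
      rw [hset] at hS1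
      have hcl : c' (d (n - 1)) = false := by rw [hc _ (by omega)]; simp
      obtain ⟨S2, hS2⟩ := hS1.pendant (x := d 0) (v := d (n - 1))
        (Or.inr ⟨0, by simp only [Set.mem_ofPred_eq]; omega, rfl⟩)
        (hd.notMem_minus (by omega) (hdU _ (by omega)))
        (hd.wrap.mono' (Set.subset_univ _)).symm'
        (by rw [hcl, hc _ (by omega)]; simp; omega)
      rw [union_minus U d n (n - 1) (by omega)] at hS2
      refine ⟨_, S2, c', Set.subset_union_left, ⟨u, Or.inr huD, hu⟩, hU.union hd.closed,
        Or.inl hw, by rw [hcU w hw, hcw], hS2.mono ?_⟩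
      rintro v - (h | h) hcv
      · exact h.1.1
      · have h : v = d (n - 1) := h
        rw [h, hcl] at hcv
        exact absurd hcv (by simp)
  · apply State.success hreg hnb hconn hF _ (R := U) (Z := ∅) (c := c) le_rfl
    refine ⟨hU, ?_, ?_, Set.empty_subset _, Set.Subset.rfl, hw, hcw, ?_, ?_, ?_, Or.inr hne⟩
    · intro a b _ h; exact absurd h (Set.notMem_empty _)
    · intro a h; exact absurd h (Set.notMem_empty _)
    · intro p hp q hq _ _
      exact ⟨U, S, Set.Subset.rfl, Set.Subset.rfl, hU, hw, hp, hq,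
        hg.mono (fun v _ h _ => absurd h (Set.notMem_empty _))⟩
    · intro a h; exact absurd h (Set.notMem_empty _)
    · intro x hx _ hcx z hz hxz
      exact hex ⟨x, hx, hcx, z, hz, hxz⟩

lemma final (hreg : G.IsRegular) (hnb : ¬ G.IsBipartite) (hconn : G.Connected)
    {F : Set E} (hF : ∀ v, G.degOn F v = 2) {w : V} {lam : Bool} (k : ℕ) :
    ∀ {U : Set V} {S : Set E} {c : V → Bool}, Uᶜ.ncard ≤ k → G.FClosed F U → w ∈ U →
      c w = lam → G.Good c U S ∅ → ∃ S c, c w = lam ∧ G.Good c Set.univ S ∅ := by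
  induction k with
  | zero =>
    intro U S c hk hU hw hcw hg
    have : Uᶜ = ∅ := (Set.ncard_eq_zero (Set.toFinite _)).1 (by omega)
    rw [Set.compl_empty_iff] at this
    subst this
    exact ⟨S, c, hcw, hg⟩
  | succ k ih =>
    intro U S c hk hU hw hcw hg
    by_cases hne : U = Set.univ
    · subst hne
      exact ⟨S, c, hcw, hg⟩
    · obtain ⟨U', S', c', hsub, ⟨v, hv, hvU⟩, hU', hw', hcw', hg'⟩ :=
        extend hreg hnb hconn hF hU hw hcw hg hne
      refine ih ?_ hU' hw' hcw' hg'
      have : U'ᶜ.ncard < Uᶜ.ncard := by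
        apply Set.ncard_lt_ncard _ (Set.toFinite _)
        exact ⟨Set.compl_subset_compl.2 hsub, fun h1 => h1 (show v ∈ Uᶜ from hvU) hv⟩
      omega

end
end Multigraph

/-- Suppose `G` is a regular nonbipartite connected multigraph
that has a 2-factor, `w ∈ V(G)` and `lam ∈ {0,1}` (here `false` encodes type 0
and `true` encodes type 1). Then `G` has a spanning even `(w, lam)`-tree: a
spanning tree `T` (with edge set `S`) such that in the bipartition `c` of `T`
in which `w` has type `lam`, every leaf of `T` has type 0. -/
theorem spanning_even_rooted_tree_of_two_factor {V E : Type} [Fintype V] [Fintype E]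
    (G : Multigraph V E) (hreg : G.IsRegular) (hnb : ¬ G.IsBipartite)
    (hconn : G.Connected)
    (h2f : ∃ F : Set E, ∀ v : V, G.degOn F v = 2)
    (w : V) (lam : Bool) :
    ∃ (S : Set E) (c : V → Bool),
      G.IsTree Set.univ S ∧
      G.ProperOn S c ∧
      c w = lam ∧
      ∀ v : V, G.IsLeaf S v → c v = false := by
  obtain ⟨F, hF⟩ := h2f
  obtain ⟨U, S, c, -, -, hU, hw, hcw, hg⟩ := Multigraph.seed hreg hnb hconn hF w lam
  obtain ⟨S', c', hcw', hg'⟩ := Multigraph.final hreg hnb hconn hF _ le_rfl hU hw hcw hg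
  refine ⟨S', c', hg'.tree, hg'.proper, hcw', ?_⟩
  intro v hv
  by_contra h
  have h2 := hg'.deg2 v (Set.mem_univ _) (by simpa using h) (Set.notMem_empty _)
  unfold Multigraph.IsLeaf at hv
  omega
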